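/- Let C ∈ [0,∞), let Y be a complete separable metric space, and let μ_n (n ∈ ℕ) and μ be Borel probability measures on Y with μ_n converging weakly to μ. Suppose that every μ_n satisfies the logarithmic Sobolev inequality with constant C: for every bounded Lipschitz f : Y → ℝ, Ent_{μ_n}(f²) ≤ 2C² ∫_Y lip_a(f)² dμ_n. Then μ satisfies the same inequality: for every bounded Lipschitz f : Y → ℝ, Ent_μ(f²) ≤ 2C² ∫_Y lip_a(f)² dμ. (The logarithmic Sobolev constant is lower semicontinuous under weak convergence.) -/

import Mathlib

open MeasureTheory ENNReal NNReal Filter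

/-- The Lipschitz constant of `f` restricted to a set `s`, valued in `[0,∞]`. -/
noncomputable def lipConstOn {Y : Type*} [MetricSpace Y] (f : Y → ℝ) (s : Set Y) : ℝ≥0∞ :=
  ⨆ (y ∈ s) (z ∈ s) (_ : y ≠ z), edist (f y) (f z) / edist y z

/-- The asymptotic Lipschitz constant of `f` at `x`:
`lip_a(f)(x) = inf_{r>0} Lip(f|_{B_r(x)})`, valued in `[0,∞]`. -/
noncomputable def asympLip {Y : Type*} [MetricSpace Y] (f : Y → ℝ) (x : Y) : ℝ≥0∞ :=
  ⨅ (r : ℝ) (_ : 0 < r), lipConstOn f (Metric.closedBall x r)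

/-- The entropy `Ent_μ(g) = ∫ g log g dμ − (∫ g dμ) log (∫ g dμ)` of a function `g`,
with the convention `0 log 0 = 0` (note `Real.log 0 = 0`). -/
noncomputable def entropy {Y : Type*} [MeasurableSpace Y] (μ : Measure Y) (g : Y → ℝ) : ℝ :=
  (∫ x, g x * Real.log (g x) ∂μ) - (∫ x, g x ∂μ) * Real.log (∫ x, g x ∂μ)

/-- The logarithmic Sobolev inequality with constant `C` for a Borel probability measure `μ`:
`Ent_μ(f²) ≤ 2C² ∫ lip_a(f)² dμ` for every bounded Lipschitz `f`. -/
def LogSobolevIneq {Y : Type*} [MetricSpace Y] [MeasurableSpace Y]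
    (C : ℝ) (μ : Measure Y) : Prop :=
  ∀ f : Y → ℝ, (∃ K : ℝ≥0, LipschitzWith K f) → (∃ C' : ℝ, ∀ x, |f x| ≤ C') →
    ENNReal.ofReal (entropy μ (fun x => (f x) ^ 2)) ≤
      ENNReal.ofReal (2 * C ^ 2) * ∫⁻ x, asympLip f x ^ 2 ∂μ

lemma asympLip_usc {Y : Type*} [MetricSpace Y] (f : Y → ℝ) :
    UpperSemicontinuous (asympLip f) := by
  intro x c hc
  simp only [asympLip, iInf_lt_iff] at hc
  obtain ⟨r, hr, h⟩ := hc
  filter_upwards [Metric.ball_mem_nhds x (half_pos hr)] with y hy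
  refine lt_of_le_of_lt ?_ h
  refine (iInf₂_le (r / 2) (half_pos hr)).trans ?_
  have hsub : Metric.closedBall y (r / 2) ⊆ Metric.closedBall x r := by
    apply Metric.closedBall_subset_closedBall'
    have := Metric.mem_ball.1 hy
    linarith
  unfold lipConstOn
  refine iSup₂_le fun a ha => iSup₂_le fun b hb => iSup_le fun hab => ?_
  exact le_iSup₂_of_le a (hsub ha) (le_iSup₂_of_le b (hsub hb) (le_iSup_of_le hab le_rfl))

lemma asympLip_le {Y : Type*} [MetricSpace Y] {f : Y → ℝ} {K : ℝ≥0}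
    (hf : LipschitzWith K f) (x : Y) : asympLip f x ≤ K := by
  refine (iInf₂_le 1 one_pos).trans ?_
  refine iSup₂_le fun a _ => iSup₂_le fun b _ => iSup_le fun _ => ?_
  exact ENNReal.div_le_of_le_mul (hf a b)

lemma limsup_lintegral_usc {Y : Type*} [TopologicalSpace Y] [MeasurableSpace Y] [BorelSpace Y]
    (μs : ℕ → Measure Y) (μ : Measure Y)
    [∀ n, IsProbabilityMeasure (μs n)] [IsProbabilityMeasure μ]
    (hcl : ∀ F : Set Y, IsClosed F → limsup (fun n => μs n F) atTop ≤ μ F)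
    (G : Y → ℝ≥0∞) (hG : UpperSemicontinuous G) (M : ℝ≥0) (hM : ∀ x, G x ≤ M) :
    limsup (fun n => ∫⁻ x, G x ∂(μs n)) atTop ≤ ∫⁻ x, G x ∂μ := by
  have hfin : ∀ x, G x ≠ ∞ := fun x => ne_top_of_le_ne_top coe_ne_top (hM x)
  have hme : Measurable fun x => (G x).toReal := hG.measurable.ennreal_toReal
  have key : ∀ ν : Measure Y, ∫⁻ x, G x ∂ν = ∫⁻ t in Set.Ioi (0:ℝ), ν {a | t ≤ (G a).toReal} := by
    intro ν
    rw [← lintegral_eq_lintegral_meas_le ν (Eventually.of_forall fun x => toReal_nonneg)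
      hme.aemeasurable]
    exact lintegral_congr fun x => (ENNReal.ofReal_toReal (hfin x)).symm
  simp_rw [key]
  refine (limsup_lintegral_le ((Set.Iic (M:ℝ)).indicator 1) ?_ ?_ ?_).trans ?_
  · exact fun n => Antitone.measurable (fun s t hst => measure_mono (fun ω hω => hst.trans hω))
  · refine fun n => Eventually.of_forall fun t => ?_
    by_cases ht : t ≤ M
    · simpa [Set.indicator, ht] using prob_le_one
    · have : {a | t ≤ (G a).toReal} = ∅ := by
        ext a
        simp only [Set.mem_setOf_eq, Set.mem_empty_iff_false, iff_false, not_le]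
        exact lt_of_le_of_lt (ENNReal.toReal_mono coe_ne_top (hM a)) (not_le.1 ht)
      simp [this]
  · rw [lintegral_indicator_one measurableSet_Iic, Measure.restrict_apply measurableSet_Iic,
      Set.inter_comm, Set.Ioi_inter_Iic]
    simp
  · refine lintegral_mono fun t => hcl _ ?_
    have : {a | t ≤ (G a).toReal} = G ⁻¹' Set.Ici (ENNReal.ofReal t) := by
      ext a
      simp [ENNReal.ofReal_le_iff_le_toReal (hfin a)]
    rw [this]
    exact hG.isClosed_preimage _

/-- The set of Borel probability measures on a complete separable metric space
satisfying the logarithmic Sobolev inequality with a fixed constant `C` is closed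
under weak convergence. -/
theorem logSobolev_closed_weak_conv {Y : Type*} [MetricSpace Y] [CompleteSpace Y]
    [TopologicalSpace.SeparableSpace Y] [MeasurableSpace Y] [BorelSpace Y]
    (C : ℝ) (hC : 0 ≤ C) (μs : ℕ → Measure Y) (μ : Measure Y)
    [∀ n, IsProbabilityMeasure (μs n)] [IsProbabilityMeasure μ]
    (hconv : ∀ g : Y → ℝ, Continuous g → (∃ C' : ℝ, ∀ x, |g x| ≤ C') →
      Tendsto (fun n => ∫ x, g x ∂(μs n)) atTop (nhds (∫ x, g x ∂μ)))
    (hLS : ∀ n, LogSobolevIneq C (μs n)) :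
    LogSobolevIneq C μ := by
  intro f hf hb
  obtain ⟨K, hK⟩ := hf
  obtain ⟨B, hB⟩ := hb
  have hsq : Continuous fun x => (f x) ^ 2 := hK.continuous.pow 2
  have hsqb : ∀ x, (f x) ^ 2 ∈ Set.Icc 0 (B ^ 2) := fun x =>
    ⟨sq_nonneg _, sq_le_sq' (abs_le.1 (hB x)).1 (abs_le.1 (hB x)).2⟩
  have h1 := hconv _ hsq ⟨B ^ 2, fun x => by
    rw [abs_of_nonneg (hsqb x).1]; exact (hsqb x).2⟩
  have h2 := hconv _ (Real.continuous_mul_log.comp hsq) (by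
    obtain ⟨D, hD⟩ := (isCompact_Icc (a := (0:ℝ)) (b := B ^ 2)).exists_bound_of_continuousOn
      Real.continuous_mul_log.continuousOn
    exact ⟨D, fun x => hD _ (hsqb x)⟩)
  have hent : Tendsto (fun n => entropy (μs n) (fun x => (f x) ^ 2)) atTop
      (nhds (entropy μ (fun x => (f x) ^ 2))) :=
    h2.sub ((Real.continuous_mul_log.tendsto _).comp h1)
  have hcl : ∀ F : Set Y, IsClosed F → limsup (fun n => μs n F) atTop ≤ μ F := by
    intro F hF
    let P : ℕ → ProbabilityMeasure Y := fun n => ⟨μs n, inferInstance⟩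
    let Q : ProbabilityMeasure Y := ⟨μ, inferInstance⟩
    have hPQ : Tendsto P atTop (nhds Q) := by
      rw [ProbabilityMeasure.tendsto_iff_forall_integral_tendsto]
      intro g
      exact hconv g g.continuous ⟨‖g‖, fun x => g.norm_coe_le_norm x⟩
    exact ProbabilityMeasure.limsup_measure_closed_le_of_tendsto hPQ hF
  have husc : UpperSemicontinuous fun x => asympLip f x ^ 2 :=
    (ENNReal.continuous_pow 2).comp_upperSemicontinuous (asympLip_usc f)
      (fun a b hab => pow_le_pow_left' hab 2)
  have hlim := limsup_lintegral_usc μs μ hcl _ husc (K ^ 2) (fun x => by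
    rw [ENNReal.coe_pow]; exact pow_le_pow_left' (asympLip_le hK x) 2)
  have hentE := (ENNReal.continuous_ofReal.tendsto _).comp hent
  rw [← hentE.limsup_eq]
  refine le_trans (limsup_le_limsup (Eventually.of_forall fun n => hLS n f ⟨K, hK⟩ ⟨B, hB⟩)) ?_
  rw [ENNReal.limsup_const_mul_of_ne_top ENNReal.ofReal_ne_top]
  gcongr
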